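/- Let Q be a preorder and (P_1,c_1), (P_2,c_2) be Q-posets. Then P_1 ⪯ P_2 (i.e., u(P_1) ≤_h u(P_2)) if and only if for every v_1 ∈ P_1 there exists v_2 ∈ P_2 such that u(P_1↾v_1) ≤_h u(P_2↾v_2). -/

import Mathlib

/-- An element of the unfolding `u(P)` of a poset `P`: a finite covering chain
`v₁ v₂ … v_t` in `P` (represented as a list) such that `v₁` is a minimal element
of `P` and each `v_{i+1}` is an immediate successor (cover) of `v_i`. -/
def IsUChain {P : Type*} [PartialOrder P] (l : List P) : Prop :=
  l ≠ [] ∧ (∀ x ∈ l.head?, IsMin x) ∧ l.Chain' (· ⋖ ·)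

/-- The underlying set of the unfolding `u(P)` of a poset `P`. -/
def Unf (P : Type*) [PartialOrder P] : Type _ := {l : List P // IsUChain l}

/-- The unfolding is ordered by the prefix relation on covering chains. -/
instance {P : Type*} [PartialOrder P] : PartialOrder (Unf P) where
  le a b := a.1 <+: b.1
  le_refl a := List.prefix_refl a.1
  le_trans _ _ _ hab hbc := List.IsPrefix.trans hab hbc
  le_antisymm a b hab hba :=
    Subtype.ext (hab.eq_of_length (Nat.le_antisymm hab.length_le hba.length_le))

/-- The last element of a covering chain. -/
def lastOf {P : Type*} [PartialOrder P] (l : Unf P) : P := l.1.getLast l.2.1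

/-- The labeling of the unfolding `u(P)` induced by a labeling `c` of `P`:
a chain is labeled by the label of its last element. -/
def unfLabel {P Q : Type*} [PartialOrder P] (c : P → Q) (l : Unf P) : Q := c (lastOf l)

/-- The `h`-preorder: `Hle cA cB` holds iff there is a morphism of `Q`-posets,
i.e. a monotone map `f` with `cA x ≤ cB (f x)` for all `x`. -/
def Hle {A B Q : Type*} [Preorder A] [Preorder B] [Preorder Q]
    (cA : A → Q) (cB : B → Q) : Prop :=
  ∃ f : A → B, Monotone f ∧ ∀ x, cA x ≤ cB (f x)

theorem coneCovBy_iff {P : Type*} [PartialOrder P] {v : P} (a b : {w : P // v ≤ w}) :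
    a ⋖ b ↔ a.1 ⋖ b.1 := by
  constructor
  · rintro ⟨h, h'⟩
    exact ⟨h, fun c hac hcb => @h' ⟨c, a.2.trans hac.le⟩ hac hcb⟩
  · rintro ⟨h, h'⟩
    exact ⟨h, fun c hac hcb => h' (show a.1 < c.1 from hac) hcb⟩

/-- A covering chain of the cone over `v` starts at `v`. -/
theorem Unf.cone_eq_cons {P : Type*} [PartialOrder P] {v : P} (s : Unf {w : P // v ≤ w}) :
    s.1 = ⟨v, le_rfl⟩ :: s.1.tail := by
  obtain ⟨s, hne, hmin, hchain⟩ := s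
  cases s with
  | nil => exact absurd rfl hne
  | cons a t =>
    have ha : a = ⟨v, le_rfl⟩ :=
      (hmin a (by simp)).eq_of_ge (show (⟨v, le_rfl⟩ : {w : P // v ≤ w}) ≤ a from a.2)
    simp [ha]

/-- A covering chain whose first element lies in a cone lifts to that cone. -/
theorem exists_lift_isChain {P : Type*} [PartialOrder P] {u : P} (t : List P) :
    ∀ (v : P) (huv : u ≤ v), (v :: t).IsChain (· ⋖ ·) →
      ∃ s : List {w : P // u ≤ w}, s.map Subtype.val = t ∧
        ((⟨v, huv⟩ : {w : P // u ≤ w}) :: s).IsChain (· ⋖ ·) := by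
  induction t with
  | nil => exact fun v huv _ => ⟨[], rfl, by simp⟩
  | cons a t ih =>
    intro v huv h
    rw [List.isChain_cons_cons] at h
    obtain ⟨s, hs, hc⟩ := ih a (huv.trans h.1.le) h.2
    refine ⟨⟨a, huv.trans h.1.le⟩ :: s, by simp [hs], ?_⟩
    rw [List.isChain_cons_cons]
    exact ⟨(coneCovBy_iff _ _).2 h.1, hc⟩

theorem isUChain_append_iff {P : Type*} [PartialOrder P] (l : Unf P) (t : List P) :
    IsUChain (l.1 ++ t) ↔ (lastOf l :: t).IsChain (· ⋖ ·) := by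
  obtain ⟨l, hne, hmin, hchain⟩ := l
  have hhead : (l ++ t).head? = l.head? := by
    cases l with
    | nil => exact absurd rfl hne
    | cons a l => rfl
  have hchain' : l.IsChain (· ⋖ ·) := hchain
  have hlast : l.getLast? = some (l.getLast hne) := List.getLast?_eq_some_getLast hne
  change (l ++ t ≠ [] ∧ (∀ x ∈ (l ++ t).head?, IsMin x) ∧ (l ++ t).IsChain (· ⋖ ·)) ↔
    (l.getLast hne :: t).IsChain (· ⋖ ·)
  rw [hhead, List.isChain_append, List.isChain_cons, hlast]
  constructor
  · rintro ⟨-, -, -, h, h'⟩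
    exact ⟨fun y hy => h' _ rfl y hy, h⟩
  · rintro ⟨h, h'⟩
    refine ⟨by simp [hne], hmin, hchain', h', ?_⟩
    rintro x hx y hy
    cases hx
    exact h y hy

/-- Graft a covering chain of the cone over the last element of `l` onto `l`. -/
def Unf.graft {P : Type*} [PartialOrder P] (l : Unf P) (s : Unf {w : P // lastOf l ≤ w}) :
    Unf P :=
  ⟨l.1 ++ s.1.tail.map Subtype.val, by
    rw [isUChain_append_iff]
    have h : s.1.IsChain (· ⋖ ·) := s.2.2.2
    rw [s.cone_eq_cons] at h
    have h' := List.isChain_map_of_isChain (R := (· ⋖ ·)) (S := (· ⋖ ·)) Subtype.val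
      (fun a b hab => (coneCovBy_iff a b).1 hab) h
    simpa using h'⟩

theorem Unf.lastOf_graft {P : Type*} [PartialOrder P] (l : Unf P)
    (s : Unf {w : P // lastOf l ≤ w}) : lastOf (l.graft s) = (lastOf s).1 := by
  apply Option.some_injective
  have hl : l.1.getLast? = some (lastOf l) := List.getLast?_eq_some_getLast l.2.1
  have hs : s.1.getLast? = some (lastOf s) := List.getLast?_eq_some_getLast s.2.1
  rw [s.cone_eq_cons, List.getLast?_cons] at hs
  have hg : (l.graft s).1.getLast? = some (lastOf (l.graft s)) :=
    List.getLast?_eq_some_getLast (l.graft s).2.1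
  rw [← hg, ← Option.some_injective _ hs, Unf.graft, List.getLast?_append, List.getLast?_map, hl]
  cases s.1.tail.getLast? <;> rfl

theorem Unf.graft_le_graft_iff {P : Type*} [PartialOrder P] (l : Unf P)
    (s s' : Unf {w : P // lastOf l ≤ w}) : l.graft s ≤ l.graft s' ↔ s ≤ s' := by
  change l.1 ++ s.1.tail.map Subtype.val <+: l.1 ++ s'.1.tail.map Subtype.val ↔ s.1 <+: s'.1
  rw [s.cone_eq_cons, s'.cone_eq_cons, List.prefix_append_right_inj, List.tail_cons,
    List.tail_cons, List.prefix_map_iff_of_injective Subtype.val_injective]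
  simp

theorem Unf.exists_graft_eq {P : Type*} [PartialOrder P] {l m : Unf P} (h : l ≤ m) :
    ∃ s, l.graft s = m := by
  obtain ⟨m, hm⟩ := m
  obtain ⟨t, rfl⟩ : ∃ t, l.1 ++ t = m := h
  obtain ⟨s, rfl, hs⟩ := exists_lift_isChain t (lastOf l) le_rfl ((isUChain_append_iff l t).1 hm)
  refine ⟨⟨⟨lastOf l, le_rfl⟩ :: s, by simp, ?_, hs⟩, rfl⟩
  rintro x hx
  cases hx
  exact fun y _ => y.2

/-- The unfolding of the cone over the last element of `l` is the cone over `l` in the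
unfolding. -/
noncomputable def Unf.coneIso {P : Type*} [PartialOrder P] (l : Unf P) :
    Unf {w : P // lastOf l ≤ w} ≃o Set.Ici l :=
  RelIso.ofSurjective
    (OrderEmbedding.ofMapLEIff (fun s => (⟨l.graft s, List.prefix_append _ _⟩ : Set.Ici l))
      (l.graft_le_graft_iff))
    (fun m => (Unf.exists_graft_eq m.2).imp fun _ h => Subtype.ext h)

theorem Unf.lastOf_coneIso {P : Type*} [PartialOrder P] (l : Unf P)
    (s : Unf {w : P // lastOf l ≤ w}) : lastOf (l.coneIso s).1 = (lastOf s).1 :=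
  l.lastOf_graft s

theorem hle_cone_iff {Q P₁ P₂ : Type*} [Preorder Q] [PartialOrder P₁] [PartialOrder P₂]
    (c₁ : P₁ → Q) (c₂ : P₂ → Q) (l₁ : Unf P₁) (l₂ : Unf P₂) :
    Hle (unfLabel fun w : {w : P₁ // lastOf l₁ ≤ w} => c₁ w.1)
        (unfLabel fun w : {w : P₂ // lastOf l₂ ≤ w} => c₂ w.1) ↔
      Hle (fun x : Set.Ici l₁ => unfLabel c₁ x.1) (fun x : Set.Ici l₂ => unfLabel c₂ x.1) := by
  constructor
  · rintro ⟨f, hf, hc⟩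
    refine ⟨fun x => l₂.coneIso (f (l₁.coneIso.symm x)),
      l₂.coneIso.monotone.comp (hf.comp l₁.coneIso.symm.monotone), fun x => ?_⟩
    have h := hc (l₁.coneIso.symm x)
    simp only [unfLabel, ← Unf.lastOf_coneIso, OrderIso.apply_symm_apply] at h ⊢
    exact h
  · rintro ⟨f, hf, hc⟩
    refine ⟨fun x => l₂.coneIso.symm (f (l₁.coneIso x)),
      l₂.coneIso.symm.monotone.comp (hf.comp l₁.coneIso.monotone), fun x => ?_⟩
    have h := hc (l₁.coneIso x)
    simp only [unfLabel, ← Unf.lastOf_coneIso, OrderIso.apply_symm_apply] at h ⊢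
    exact h

theorem lastOf_surjective {P : Type*} [PartialOrder P] [Finite P] :
    Function.Surjective (lastOf : Unf P → P) := by
  intro v
  induction v using (Finite.to_wellFoundedLT (α := P)).induction with
  | ind v ih =>
    by_cases hv : IsMin v
    · exact ⟨⟨[v], by simp, by simpa using hv, List.isChain_singleton v⟩, rfl⟩
    · obtain ⟨u, hu⟩ := exists_covBy_of_wellFoundedGT hv
      obtain ⟨l, hl⟩ := ih u hu.lt
      refine ⟨⟨l.1 ++ [v], (isUChain_append_iff l [v]).2 (by simpa [hl] using hu)⟩, ?_⟩
      simp [lastOf]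

/-- The one-element chain at the bottom of a covering chain. -/
def Unf.root {P : Type*} [PartialOrder P] (l : Unf P) : Unf P :=
  ⟨[l.1.head l.2.1], by simp,
    by simpa using l.2.2.1 _ (List.head_mem_head? l.2.1), List.isChain_singleton _⟩

theorem Unf.root_le {P : Type*} [PartialOrder P] (l : Unf P) : l.root ≤ l :=
  ⟨l.1.tail, by simp [Unf.root]⟩

theorem Unf.root_eq_of_le {P : Type*} [PartialOrder P] {l m : Unf P} (h : l ≤ m) :
    l.root = m.root := by
  obtain ⟨m, hm⟩ := m
  obtain ⟨t, rfl⟩ : ∃ t, l.1 ++ t = m := h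
  exact Subtype.ext (by simp [Unf.root, List.head_append_of_ne_nil l.2.1])

/-- `P₁ ⪯ P₂` (i.e. `u(P₁) ≤_h u(P₂)`) iff for every `v₁ ∈ P₁` there
is `v₂ ∈ P₂` with `u(P₁↾v₁) ≤_h u(P₂↾v₂)`. -/
theorem stmt_3 {Q : Type*} [Preorder Q] {P₁ P₂ : Type*}
    [PartialOrder P₁] [Fintype P₁] [Nonempty P₁]
    [PartialOrder P₂] [Fintype P₂] [Nonempty P₂]
    (c₁ : P₁ → Q) (c₂ : P₂ → Q) :
    Hle (unfLabel c₁) (unfLabel c₂) ↔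
      ∀ v₁ : P₁, ∃ v₂ : P₂,
        Hle (unfLabel fun w : {w : P₁ // v₁ ≤ w} => c₁ w.1)
            (unfLabel fun w : {w : P₂ // v₂ ≤ w} => c₂ w.1) := by
  constructor
  · rintro ⟨f, hf, hc⟩ v₁
    obtain ⟨l, rfl⟩ := lastOf_surjective v₁
    refine ⟨lastOf (f l), (hle_cone_iff c₁ c₂ l (f l)).2 ?_⟩
    exact ⟨fun x => ⟨f x.1, hf x.2⟩, fun x y hxy => hf hxy, fun x => hc x.1⟩
  · intro h
    have h' : ∀ l₁ : Unf P₁, ∃ l₂ : Unf P₂,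
        Hle (fun x : Set.Ici l₁ => unfLabel c₁ x.1) (fun x : Set.Ici l₂ => unfLabel c₂ x.1) := by
      intro l₁
      obtain ⟨v₂, hv₂⟩ := h (lastOf l₁)
      obtain ⟨l₂, rfl⟩ := lastOf_surjective v₂
      exact ⟨l₂, (hle_cone_iff c₁ c₂ l₁ l₂).1 hv₂⟩
    choose r g hg hc using h'
    refine ⟨fun x => (g x.root ⟨x, x.root_le⟩).1, fun x y hxy => ?_,
      fun x => hc x.root ⟨x, x.root_le⟩⟩
    have hmono : ∀ (l : Unf P₁) (hx : l ≤ x) (hy : y.root = l),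
        (g l ⟨x, hx⟩).1 ≤ (g y.root ⟨y, y.root_le⟩).1 := by
      rintro l hx rfl
      exact hg y.root hxy
    exact hmono x.root x.root_le (Unf.root_eq_of_le hxy).symm
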